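/- Fix an integer r ≥ 1 and let s, B, b_0,…,b_{2r+1} be as defined. Define d := b_0 b_1 ⋯ b_{2r}, c_0 := b_1 b_2 ⋯ b_{2r}, and integers c_1, …, c_{2r} as follows. For 0 ≤ i ≤ r−1, c_{r+1+i} := 2·(b_{r+1−i} ⋯ b_{r+i}) · B(P_i), where the product runs over all indices j with r+1−i ≤ j ≤ r+i (and equals 1 when i = 0), and P_i is the list of length 2(r−i)−1 formed by concatenating the pairs (b_t, b_{2r+1−t}) for t = 1, …, r−i−1 followed by the single entry b_{r−i}. For 0 ≤ i ≤ r−1, c_{r−i} := 2·(b_{r+1−i} ⋯ b_{r+1+i}) · B(Q_i), where the product runs over all indices j with r+1−i ≤ j ≤ r+1+i, and Q_i is the list of length 2(r−1−i) formed by concatenating the pairs (b_t, b_{2r+1−t}) for t = 1, …, r−1−i. Then d − (c_0 + c_1 + ⋯ + c_{2r}) = 1. (These are the degree and the first 2r+1 weights of the hypersurface X of dimension n = 2r in Theorem 6.1; the identity says that K_X = O_X(1 − c_{2r+1}) where the remaining weight is c_{2r+1} = g_1.) -/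

import Mathlib

/-- Sylvester's sequence: `s 0 = 2`, `s (j+1) = s j * (s j − 1) + 1`;
it begins 2, 3, 7, 43, 1807, …. -/
def sylv : ℕ → ℕ
  | 0 => 2
  | n + 1 => sylv n * (sylv n - 1) + 1

/-- The alternating sum `B(x₁,…,x_k) = ∑_{j=0}^{k} (−1)^{k−j} x₁⋯x_j`
(the empty product being 1), characterized by `B [] = 1` and
`B (x :: xs) = x * B xs + (−1)^(length (x :: xs))`. -/
def Bsum : List ℤ → ℤ
  | [] => 1
  | x :: xs => x * Bsum xs + (-1) ^ (xs.length + 1)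

/-- `Zl r t` is the list of length `2t` formed by concatenating the pairs
`(b_{r+u}, b_{r+1−u})` for `u = 1, …, t`, where `b` are the exponents
defined inductively together with this list. -/
def Zl (r : ℕ) : ℕ → List ℤ
  | 0 => []
  | t + 1 => Zl r t ++ [1 + ((sylv (r - t) : ℤ) - 1) ^ 2 * Bsum (Zl r t), (sylv (r - t) : ℤ)]

/-- The exponents `b_0, …, b_{2r+1}`: `b_j = s_j` for `j ≤ r`, and
`b_{r+i} = 1 + (b_{r+1−i} − 1)² · B(Z_{i−1})` for `1 ≤ i ≤ r+1`
(here, for `j = r + i`, one has `b_{r+1−i} = s_{2r+1−j}`). -/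
def bexp (r j : ℕ) : ℤ :=
  if j ≤ r then (sylv j : ℤ)
  else 1 + ((sylv (2 * r + 1 - j) : ℤ) - 1) ^ 2 * Bsum (Zl r (j - r - 1))

/-- The list `L_k = (b_{r+1}, b_r, b_{r+2}, b_{r−1}, …, b_{2r+1−k}, b_k)`,
formed by concatenating the pairs `(b_{r+t}, b_{r+1−t})` for `t = 1, …, r+1−k`. -/
def Lk (r k : ℕ) : List ℤ := Zl r (r + 1 - k)

/-- `t_k := B(L_k)`. -/
def tB (r k : ℕ) : ℤ := Bsum (Lk r k)

/-- `g_k := B(reverse of L_k)`. -/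
def gB (r k : ℕ) : ℤ := Bsum (Lk r k).reverse

/-- `T_k`: the alternating sum of `B` over the suffixes of `L_k`
(the full list with sign `+`, the empty suffix contributing `+1`). -/
def TB (r k : ℕ) : ℤ :=
  ∑ m ∈ Finset.range ((Lk r k).length + 1), (-1) ^ m * Bsum ((Lk r k).drop m)

/-- `w_k := (s_k − 1)·T_k − 1`. -/
def wB (r k : ℕ) : ℤ := ((sylv k : ℤ) - 1) * TB r k - 1

/-- `PLeven r t`: the list formed by concatenating the pairs `(b_u, b_{2r+1−u})`
for `u = 1, …, t`. -/
def PLeven (r : ℕ) : ℕ → List ℤ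
  | 0 => []
  | t + 1 => PLeven r t ++ [bexp r (t + 1), bexp r (2 * r - t)]

theorem Bsum_append_singleton (l : List ℤ) (x : ℤ) :
    Bsum (l ++ [x]) = l.prod * x - Bsum l := by
  induction l with
  | nil => simp [Bsum]; ring
  | cons y l ih =>
    simp only [List.cons_append, Bsum, ih, List.prod_cons, List.length_append,
      List.length_singleton]
    ring

theorem Bsum_append_pair (l : List ℤ) (x y : ℤ) :
    Bsum (l ++ [x, y]) = l.prod * x * (y - 1) + Bsum l := by
  rw [show l ++ [x, y] = (l ++ [x]) ++ [y] by simp, Bsum_append_singleton,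
    Bsum_append_singleton, List.prod_append, List.prod_singleton]
  ring

theorem sylv_pos (j : ℕ) : 1 ≤ sylv j := by
  cases j <;> simp [sylv]

theorem sylv_succ_sub_one (j : ℕ) :
    (sylv (j + 1) : ℤ) - 1 = sylv j * ((sylv j : ℤ) - 1) := by
  simp [sylv, Nat.cast_sub (sylv_pos j)]

theorem bexp_of_le {r j : ℕ} (h : j ≤ r) : bexp r j = sylv j := if_pos h

theorem bexp_add_succ (r n : ℕ) :
    bexp r (r + 1 + n) = 1 + ((sylv (r - n) : ℤ) - 1) ^ 2 * Bsum (Zl r n) := by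
  rw [bexp, if_neg (by omega), show 2 * r + 1 - (r + 1 + n) = r - n by omega,
    show r + 1 + n - r - 1 = n by omega]

theorem Zl_succ (r n : ℕ) : Zl r (n + 1) = Zl r n ++ [bexp r (r + 1 + n), bexp r (r - n)] := by
  rw [bexp_add_succ, bexp_of_le (Nat.sub_le r n), Zl]

theorem prod_Icc_bexp (r n : ℕ) (h : n ≤ r) :
    ∏ j ∈ Finset.Icc (r + 1 - n) (r + n), bexp r j = (Zl r n).prod := by
  induction n with
  | zero => simp [Zl]
  | succ n ih =>
    rw [Zl_succ, List.prod_append, ← ih (by omega), show r + (n + 1) = r + n + 1 by omega,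
      Finset.prod_Icc_succ_top (by omega),
      ← Finset.mul_prod_Ioc_eq_prod_Icc (show r + 1 - (n + 1) ≤ r + n by omega),
      ← Finset.Icc_succ_left_eq_Ioc, Order.succ_eq_add_one,
      show r + 1 - (n + 1) + 1 = r + 1 - n by omega,
      show r + 1 - (n + 1) = r - n by omega, show r + n + 1 = r + 1 + n by omega]
    simp only [List.prod_cons, List.prod_nil]
    ring

/-- Closed form for the sum of the innermost `2n` weights, as a linear combination of the product
and the alternating sum of the remaining outer list `PLeven r (r - n)`. -/
theorem mul_sum_weights (r n : ℕ) (h : n ≤ r) :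
    ((sylv (r - n + 1) : ℤ) - 1) *
      ((∑ i ∈ Finset.range n,
          2 * (∏ j ∈ Finset.Icc (r + 1 - i) (r + i), bexp r j) *
            Bsum (PLeven r (r - i - 1) ++ [bexp r (r - i)])) +
       (∑ i ∈ Finset.range n,
          2 * (∏ j ∈ Finset.Icc (r + 1 - i) (r + 1 + i), bexp r j) *
            Bsum (PLeven r (r - 1 - i)))) =
    2 * ((Zl r n).prod - 1) * (PLeven r (r - n)).prod +
      2 * ((sylv (r - n + 1) : ℤ) - 1) * ((Zl r n).prod - Bsum (Zl r n)) *
        (Bsum (PLeven r (r - n)) - (PLeven r (r - n)).prod) := by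
  induction n with
  | zero => simp [Zl, Bsum]
  | succ n ih =>
    obtain ⟨k, rfl⟩ : ∃ k, r = k + 1 + n := ⟨r - (n + 1), by omega⟩
    have ih := ih (by omega)
    have hprod : ∏ j ∈ Finset.Icc (k + 1 + n + 1 - n) (k + 1 + n + 1 + n), bexp (k + 1 + n) j =
        (Zl (k + 1 + n) n).prod * bexp (k + 1 + n) (k + 1 + n + 1 + n) := by
      rw [← prod_Icc_bexp _ n (by omega), show k + 1 + n + 1 + n = k + 1 + n + n + 1 by omega,
        Finset.prod_Icc_succ_top (by omega)]
    rw [Finset.sum_range_succ, Finset.sum_range_succ, hprod, prod_Icc_bexp _ n (by omega),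
      Zl_succ, Bsum_append_pair, Bsum_append_singleton, List.prod_append]
    have hb := bexp_add_succ (k + 1 + n) n
    have hs : bexp (k + 1 + n) (k + 1) = sylv (k + 1) := bexp_of_le (by omega)
    have hs0 : (sylv (k + 1) : ℤ) ≠ 0 := by
      exact_mod_cast Nat.one_le_iff_ne_zero.mp (sylv_pos (k + 1))
    have ha : 2 * (k + 1 + n) - k = k + 1 + n + 1 + n := by omega
    simp only [show k + 1 + n - n = k + 1 by omega, show k + 1 + n - (n + 1) = k by omega,
      show k + 1 + n - 1 - n = k by omega, Nat.add_sub_cancel, hs, PLeven, ha, Bsum_append_pair,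
      List.prod_append, List.prod_cons, List.prod_nil, mul_one, sylv_succ_sub_one (k + 1)]
      at ih hb ⊢
    generalize (∑ i ∈ Finset.range n, _ : ℤ) = S at ih ⊢
    generalize (∑ i ∈ Finset.range n, _ : ℤ) = S' at ih ⊢
    generalize bexp (k + 1 + n) (k + 1 + n + 1 + n) = a at *
    generalize (sylv (k + 1) : ℤ) = s at *
    generalize (Zl (k + 1 + n) n).prod = Q at *
    generalize Bsum (Zl (k + 1 + n) n) = z at *
    generalize (PLeven (k + 1 + n) k).prod = p at *
    generalize Bsum (PLeven (k + 1 + n) k) = b at *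
    refine mul_left_cancel₀ hs0 ?_
    linear_combination ih - 2 * p * s * hb

/-- The degree and weight identity `d − (c_0 + ⋯ + c_{2r}) = 1` for the hypersurface
`X` of even dimension `n = 2r` in Theorem 6.1 of Esser–Totaro. Here
`d = b_0 ⋯ b_{2r}`, `c_0 = b_1 ⋯ b_{2r}`,
`c_{r+1+i} = 2·(b_{r+1−i} ⋯ b_{r+i}) · B(P_i)` with
`P_i = PLeven r (r−i−1) ++ [b_{r−i}]`, and
`c_{r−i} = 2·(b_{r+1−i} ⋯ b_{r+1+i}) · B(Q_i)` with `Q_i = PLeven r (r−1−i)`,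
for `0 ≤ i ≤ r−1`. -/
theorem even_degree_weight_identity (r : ℕ) (hr : 1 ≤ r) :
    (∏ j ∈ Finset.range (2 * r + 1), bexp r j) -
      ((∏ j ∈ Finset.Icc 1 (2 * r), bexp r j) +
       (∑ i ∈ Finset.range r,
          2 * (∏ j ∈ Finset.Icc (r + 1 - i) (r + i), bexp r j) *
            Bsum (PLeven r (r - i - 1) ++ [bexp r (r - i)])) +
       (∑ i ∈ Finset.range r,
          2 * (∏ j ∈ Finset.Icc (r + 1 - i) (r + 1 + i), bexp r j) *
            Bsum (PLeven r (r - 1 - i)))) = 1 := by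
  have hsum := mul_sum_weights r r le_rfl
  have hc : ∏ j ∈ Finset.Icc 1 (2 * r), bexp r j = (Zl r r).prod := by
    rw [← prod_Icc_bexp r r le_rfl, show r + 1 - r = 1 by omega, two_mul]
  have hd : ∏ j ∈ Finset.range (2 * r + 1), bexp r j = 2 * (Zl r r).prod := by
    rw [← hc, Finset.range_eq_Ico, Finset.prod_eq_prod_Ico_succ_bot (by omega),
      bexp_of_le (Nat.zero_le r)]
    rfl
  rw [hd, hc]
  simp only [Nat.sub_self, PLeven, Bsum, List.prod_nil, sylv] at hsum
  norm_num at hsum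
  linarith
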